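/- arXiv:1606.05616 — 5 statements merged into one kernel-verified Lean document; each statement's English description precedes it below -/
import Mathlib

section
/- Let n be a natural number divisible by 3 and let G be a simple graph on a vertex set V of size n with more than (5/9)·(n choose 2) edges. Then G has a connected component containing more than 2n/3 vertices. -/
namespace SimpleGraph

open Classical in
theorem degree_add_one_le_ncard_supp {V : Type*} [Fintype V] (G : SimpleGraph V) (v : V) :
    G.degree v + 1 ≤ (G.connectedComponentMk v).supp.ncard := by
  rw [← G.card_neighborFinset_eq_degree, ← Finset.card_insert_of_notMem
    (G.notMem_neighborFinset_self v), ← Set.ncard_coe_finset]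
  refine Set.ncard_le_ncard ?_ (Set.toFinite _)
  intro w hw
  simp only [Finset.coe_insert, Set.mem_insert_iff, Finset.mem_coe, mem_neighborFinset] at hw
  rw [ConnectedComponent.mem_supp_iff, ConnectedComponent.eq]
  rcases hw with rfl | h
  · exact Reachable.refl _
  · exact h.symm.reachable

/-- A graph on `3 * m` vertices whose components all have at most `2 * m` vertices has at most
`m * (5 * m - 3) / 2` edges. -/
theorem two_mul_ncard_edgeSet_add_le {V : Type*} [Fintype V] (G : SimpleGraph V) (m : ℕ)
    (hV : Fintype.card V = 3 * m) (h : ∀ c : G.ConnectedComponent, c.supp.ncard ≤ 2 * m) :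
    2 * G.edgeSet.ncard + 3 * m ≤ 5 * m ^ 2 := by
  classical
  have hsum : 2 * G.edgeSet.ncard + 3 * m = ∑ v, (G.degree v + 1) := by
    rw [Finset.sum_add_distrib, G.sum_degrees_eq_twice_card_edges, ← coe_edgeFinset,
      Set.ncard_coe_finset]
    simp [hV]
  rw [hsum]
  by_cases hm : ∀ c : G.ConnectedComponent, c.supp.ncard ≤ m
  · calc ∑ v, (G.degree v + 1) ≤ ∑ _v : V, m :=
          Finset.sum_le_sum fun v _ => (G.degree_add_one_le_ncard_supp v).trans (hm _)
      _ = 3 * m * m := by simp [hV]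
      _ ≤ 5 * m ^ 2 := by nlinarith
  · push Not at hm
    obtain ⟨c, hc⟩ := hm
    obtain ⟨k, hk⟩ : ∃ k, c.supp.ncard + k = 3 * m :=
      ⟨3 * m - c.supp.ncard, by have := h c; omega⟩
    have hcompl : c.suppᶜ.ncard = k := by
      have := Set.ncard_add_ncard_compl c.supp
      rw [Nat.card_eq_fintype_card, hV] at this
      omega
    have hin : ∑ v ∈ c.supp.toFinset, (G.degree v + 1) ≤ c.supp.ncard * c.supp.ncard := by
      conv_rhs => rw [Set.ncard_eq_toFinset_card']
      refine Finset.sum_le_card_nsmul _ _ _ fun v hv => ?_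
      rw [Set.mem_toFinset, ConnectedComponent.mem_supp_iff] at hv
      rw [← Set.ncard_eq_toFinset_card', ← hv]
      exact G.degree_add_one_le_ncard_supp v
    have hout : ∑ v ∈ c.supp.toFinsetᶜ, (G.degree v + 1) ≤ k * k := by
      have hcard : c.supp.toFinsetᶜ.card = k := by
        rw [← hcompl, ← Set.ncard_coe_finset]
        simp
      conv_rhs => rw [← hcard]
      refine Finset.sum_le_card_nsmul _ _ _ fun v hv => ?_
      rw [hcard, ← hcompl]
      refine (G.degree_add_one_le_ncard_supp v).trans
        (Set.ncard_le_ncard (fun w hw hwc => ?_) (Set.toFinite _))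
      rw [Finset.mem_compl, Set.mem_toFinset, ConnectedComponent.mem_supp_iff] at hv
      rw [ConnectedComponent.mem_supp_iff] at hw hwc
      exact hv (hw.symm.trans hwc)
    rw [← Finset.sum_add_sum_compl c.supp.toFinset]
    refine (add_le_add hin hout).trans ?_
    have h2 := h c
    zify at hc hk h2 ⊢
    have hk' : (k : ℤ) = 3 * m - c.supp.ncard := by linarith
    rw [hk']
    nlinarith [mul_nonneg (sub_nonneg.2 hc.le) (sub_nonneg.2 h2)]

end SimpleGraph

/-- **Lemma (graphmeet (i)).** If `3 ∣ n` and `G` is a graph on `n` vertices with more than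
`(5/9)·(n choose 2)` edges, then `G` has a connected component with more than `2n/3`
vertices. -/
theorem large_component_of_dense_graph {V : Type} [Fintype V] (n : ℕ)
    (hn : Fintype.card V = n) (h3 : 3 ∣ n) (G : SimpleGraph V)
    (he : (5 : ℝ) / 9 * (n.choose 2) < (G.edgeSet.ncard : ℝ)) :
    ∃ c : G.ConnectedComponent, (2 : ℝ) * n / 3 < (c.supp.ncard : ℝ) := by
  obtain ⟨m, rfl⟩ := h3
  by_contra! hcon
  have hle : ∀ c : G.ConnectedComponent, c.supp.ncard ≤ 2 * m := by
    intro c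
    have h := hcon c
    push_cast at h
    have h' : (c.supp.ncard : ℝ) ≤ ((2 * m : ℕ) : ℝ) := by push_cast; linarith
    exact_mod_cast h'
  have hedge : (2 : ℝ) * G.edgeSet.ncard + 3 * m ≤ 5 * (m : ℝ) ^ 2 := by
    exact_mod_cast G.two_mul_ncard_edgeSet_add_le m hn hle
  rw [Nat.cast_choose_two] at he
  push_cast at he
  have hm : (0 : ℝ) ≤ m := m.cast_nonneg
  nlinarith
end

section
/- Let n be a natural number divisible by 3 and let G be a simple graph on a vertex set V of size n with more than (5/9)·(n choose 2) edges. Then a connected component of G with the largest number of vertices contains more than (4/9)·(n choose 2) edges of G. -/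
open Finset in
/-- A finite vertex set `s` spans at most `#s.choose 2` edges. -/
theorem SimpleGraph.ncard_edges_within_le_choose_two {V : Type*} (G : SimpleGraph V)
    (s : Finset V) :
    ({e | e ∈ G.edgeSet ∧ ∀ v ∈ e, v ∈ s} : Set (Sym2 V)).ncard ≤ (#s).choose 2 := by
  classical
  rw [← Sym2.card_image_offDiag, ← Set.ncard_coe_finset]
  refine Set.ncard_le_ncard ?_ (Finset.finite_toSet _)
  rintro ⟨a, b⟩ ⟨hab, hs⟩
  have hadj : G.Adj a b := hab
  exact Finset.mem_coe.2 <| Finset.mem_image.2 ⟨(a, b), Finset.mem_offDiag.2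
    ⟨hs a (Sym2.mem_mk_left a b), hs b (Sym2.mem_mk_right a b), hadj.ne⟩, rfl⟩

/-- If every component has at most `m` vertices, the graph has at most `n * (m - 1) / 2` edges. -/
theorem SimpleGraph.two_mul_ncard_edgeSet_add_card_le {V : Type*} [Fintype V]
    (G : SimpleGraph V) (m : ℕ) (hm : ∀ c : G.ConnectedComponent, c.supp.ncard ≤ m) :
    2 * G.edgeSet.ncard + Fintype.card V ≤ Fintype.card V * m := by
  classical
  have hdeg (v : V) : G.degree v + 1 ≤ m := by
    refine le_trans ?_ (hm (G.connectedComponentMk v))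
    rw [← G.card_neighborFinset_eq_degree,
      ← Finset.card_insert_of_notMem (G.notMem_neighborFinset_self v), ← Set.ncard_coe_finset]
    refine Set.ncard_le_ncard ?_ (Set.toFinite _)
    intro w hw
    rw [Finset.mem_coe, Finset.mem_insert, G.mem_neighborFinset] at hw
    rw [SimpleGraph.ConnectedComponent.mem_supp_iff, SimpleGraph.ConnectedComponent.eq]
    rcases hw with rfl | hw
    · rfl
    · exact hw.symm.reachable
  have hsum := Finset.sum_le_sum fun v (_ : v ∈ Finset.univ) => hdeg v
  rw [Finset.sum_add_distrib, G.sum_degrees_eq_twice_card_edges] at hsum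
  rw [← G.coe_edgeFinset, Set.ncard_coe_finset]
  simpa using hsum

/-- The edges of a graph are split between a component and the complement of that component. -/
theorem SimpleGraph.ConnectedComponent.ncard_edgeSet_le {V : Type*} [Fintype V]
    {G : SimpleGraph V} (c : G.ConnectedComponent) :
    G.edgeSet.ncard ≤ ({e | e ∈ G.edgeSet ∧ ∀ v ∈ e, v ∈ c.supp} : Set (Sym2 V)).ncard +
      ({e | e ∈ G.edgeSet ∧ ∀ v ∈ e, v ∈ c.suppᶜ} : Set (Sym2 V)).ncard := by
  classical
  refine le_trans (Set.ncard_le_ncard ?_ (Set.toFinite _)) (Set.ncard_union_le _ _)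
  rintro ⟨a, b⟩ hab
  have hiff : a ∈ c.supp ↔ b ∈ c.supp := c.mem_supp_congr_adj hab
  by_cases ha : a ∈ c.supp
  · refine Or.inl ⟨hab, fun v hv => ?_⟩
    rcases Sym2.mem_iff.1 hv with rfl | rfl
    exacts [ha, hiff.1 ha]
  · refine Or.inr ⟨hab, fun v hv => ?_⟩
    rcases Sym2.mem_iff.1 hv with rfl | rfl
    exacts [ha, fun hb => ha (hiff.2 hb)]

/-- **Lemma (graphmeet (ii)).** If `3 ∣ n` and `G` is a graph on `n` vertices with more than
`(5/9)·(n choose 2)` edges, then any connected component of `G` with the largest number of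
vertices contains more than `(4/9)·(n choose 2)` edges of `G`. -/
theorem largest_component_many_edges {V : Type} [Fintype V] (n : ℕ)
    (hn : Fintype.card V = n) (h3 : 3 ∣ n) (G : SimpleGraph V)
    (he : (5 : ℝ) / 9 * (n.choose 2) < (G.edgeSet.ncard : ℝ))
    (c : G.ConnectedComponent)
    (hc : ∀ c' : G.ConnectedComponent, c'.supp.ncard ≤ c.supp.ncard) :
    (4 : ℝ) / 9 * (n.choose 2) <
      (({e | e ∈ G.edgeSet ∧ ∀ v ∈ e, v ∈ c.supp} : Set (Sym2 V)).ncard : ℝ) := by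
  classical
  have hdeg := G.two_mul_ncard_edgeSet_add_card_le _ hc
  have hsplit := c.ncard_edgeSet_le
  have hin := G.ncard_edges_within_le_choose_two c.supp.toFinset
  have hout := G.ncard_edges_within_le_choose_two c.suppᶜ.toFinset
  have hcard := Set.ncard_add_ncard_compl c.supp
  simp only [Set.mem_toFinset, ← Set.ncard_eq_toFinset_card'] at hin hout
  rw [Nat.card_eq_fintype_card, hn] at hcard
  rw [hn] at hdeg
  generalize ({e | e ∈ G.edgeSet ∧ ∀ v ∈ e, v ∈ c.supp} : Set (Sym2 V)).ncard = x at *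
  generalize ({e | e ∈ G.edgeSet ∧ ∀ v ∈ e, v ∈ c.suppᶜ} : Set (Sym2 V)).ncard = y at *
  generalize G.edgeSet.ncard = e at *
  generalize c.supp.ncard = m at *
  generalize c.suppᶜ.ncard = l at *
  obtain ⟨k, rfl⟩ := h3
  have hk : 1 ≤ k := by
    by_contra! h
    obtain rfl : k = 0 := by omega
    have : (0 : ℝ) < e := by simpa using he
    have : 0 < e := by exact_mod_cast this
    omega
  replace hin : (x : ℝ) ≤ m * (m - 1) / 2 := by
    rw [← Nat.cast_choose_two]; exact_mod_cast hin
  replace hout : (y : ℝ) ≤ l * (l - 1) / 2 := by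
    rw [← Nat.cast_choose_two]; exact_mod_cast hout
  rw [Nat.cast_choose_two] at he ⊢
  have hdeg' : (2 : ℝ) * e + (3 * k : ℕ) ≤ (3 * k : ℕ) * m := by exact_mod_cast hdeg
  have hsplit' : (e : ℝ) ≤ x + y := by exact_mod_cast hsplit
  have hcard' : (m : ℝ) + l = (3 * k : ℕ) := by exact_mod_cast hcard
  have hk' : (1 : ℝ) ≤ k := by exact_mod_cast hk
  push_cast at *
  have hl0 : (0 : ℝ) ≤ l := l.cast_nonneg
  rcases le_or_gt l k with hlk | hlk
  · have hlk' : (l : ℝ) ≤ k := by exact_mod_cast hlk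
    rcases Nat.eq_zero_or_pos l with rfl | hl
    · simp only [Nat.cast_zero, zero_mul, zero_div] at hout
      nlinarith
    · have hl' : (1 : ℝ) ≤ l := by exact_mod_cast hl
      have : (l : ℝ) * (l - 1) ≤ k * (k - 1) := by gcongr
      nlinarith
  · exfalso
    have hlk' : (k : ℝ) + 1 ≤ l := by exact_mod_cast hlk
    have hm : 5 * (3 * (k : ℝ) - 1) < 9 * (m - 1) := by
      have h : 0 < 3 * (k : ℝ) * (9 * (m - 1) - 5 * (3 * k - 1)) := by linarith
      have := pos_of_mul_pos_right h (by linarith)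
      linarith
    have hm_eq : (m : ℝ) = 3 * k - l := by linarith
    rw [hm_eq] at hin hm
    nlinarith [mul_nonneg (sub_nonneg.2 hlk') (by linarith : (0 : ℝ) ≤ 2 * k - 1 - l)]
end

section
/- Let n be a natural number divisible by 3 and let G be a simple graph on a vertex set V of size n with more than (5/9)·(n choose 2) edges. Then a connected component of G with the largest number of vertices contains a matching of size n/3, i.e. there are n/3 pairwise disjoint edges of G all lying inside that component. -/
open Finset

namespace SimpleGraph

variable {W : Type*}

section Counting

variable (H : SimpleGraph W) [DecidableRel H.Adj]

/-- The number of pairs in `S ×ˢ T` that are adjacent in `H`. -/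
def adjCount (S T : Finset W) : ℕ := ∑ p ∈ S, #{q ∈ T | H.Adj p q}

lemma adjCount_comm (S T : Finset W) : H.adjCount S T = H.adjCount T S := by
  simp only [adjCount, card_filter]
  rw [sum_comm]
  simp only [H.adj_comm]

variable {H}

lemma adjCount_union_left [DecidableEq W] {S S' : Finset W} (T : Finset W) (h : Disjoint S S') :
    H.adjCount (S ∪ S') T = H.adjCount S T + H.adjCount S' T :=
  sum_union h

lemma adjCount_union_right [DecidableEq W] (S : Finset W) {T T' : Finset W} (h : Disjoint T T') :
    H.adjCount S (T ∪ T') = H.adjCount S T + H.adjCount S T' := by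
  rw [adjCount_comm, adjCount_union_left _ h, adjCount_comm, H.adjCount_comm T']

variable (H) in
lemma adjCount_le (S T : Finset W) : H.adjCount S T ≤ #S * #T := by
  simpa [adjCount] using sum_le_card_nsmul S _ _ fun p _ ↦ card_filter_le T (H.Adj p)

variable (H) in
lemma adjCount_self_le (S : Finset W) : H.adjCount S S + #S ≤ #S * #S := by
  have : ∀ p ∈ S, #{q ∈ S | H.Adj p q} + 1 ≤ #S := fun p hp ↦
    card_lt_card (filter_ssubset.2 ⟨p, hp, H.irrefl⟩)
  simpa [sum_add_distrib, adjCount] using sum_le_card_nsmul S _ _ this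

end Counting

/-- A matching of `H`, encoded as the involution exchanging the endpoints of each of its edges and
fixing the unmatched vertices. -/
def IsMatchingInvolution (H : SimpleGraph W) (m : W → W) : Prop :=
  (∀ v, m (m v) = v) ∧ ∀ v, m v ≠ v → H.Adj v (m v)

variable [Fintype W] [DecidableEq W]

/-- A matching involution leaving as few vertices unmatched as possible. -/
def IsMaximumInvolution (H : SimpleGraph W) (m : W → W) : Prop :=
  H.IsMatchingInvolution m ∧
    ∀ m', H.IsMatchingInvolution m' → #{v | m v = v} ≤ #{v | m' v = v}

lemma exists_isMaximumInvolution (H : SimpleGraph W) : ∃ m, H.IsMaximumInvolution m := by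
  obtain ⟨m, hm, hmin⟩ := Set.exists_min_image {m : W → W | H.IsMatchingInvolution m}
    (fun m ↦ #{v | m v = v}) (Set.toFinite _) ⟨id, by simp [IsMatchingInvolution]⟩
  exact ⟨m, hm, hmin⟩

namespace IsMaximumInvolution

variable {H : SimpleGraph W} {m : W → W} {u v x z : W}

lemma fixed_of_forall_fixed (h : H.IsMaximumInvolution m) {m' : W → W} (h' : H.IsMatchingInvolution m')
    (hsub : ∀ w, m' w = w → m w = w) (hu : m u = u) : m' u = u := by
  by_contra hne
  refine (h.2 m' h').not_gt (card_lt_card ?_)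
  refine ⟨fun w hw ↦ ?_, fun hs ↦ hne ?_⟩
  · simpa using hsub w (by simpa using hw)
  · simpa using hs (by simpa using hu)

lemma not_adj_of_fixed (h : H.IsMaximumInvolution m) (hu : m u = u) (hv : m v = v) :
    ¬ H.Adj u v := by
  intro ha
  have hne := ha.ne
  have hs := ha.symm
  obtain ⟨h1, h2⟩ := h.1
  have := h.fixed_of_forall_fixed (m' := fun w ↦ if w = u then v else if w = v then u else m w)
    ⟨fun w ↦ by grind, fun w ↦ by grind⟩ (fun w ↦ by grind) hu
  grind

lemma not_adj_partner (h : H.IsMaximumInvolution m) (hu : m u = u) (hv : m v = v) (huv : u ≠ v)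
    (hx : m x ≠ x) (hxu : H.Adj x u) : ¬ H.Adj (m x) v := by
  intro ha
  have hs := ha.symm
  have hs' := hxu.symm
  obtain ⟨h1, h2⟩ := h.1
  have := h.fixed_of_forall_fixed (m' := fun w ↦ if w = u then x else if w = x then u else
    if w = v then m x else if w = m x then v else m w)
    ⟨fun w ↦ by grind, fun w ↦ by grind⟩ (fun w ↦ by grind) hu
  grind

/-- Replacing the matching edge at `x` by an edge from `x` to an unmatched vertex `u`. -/
lemma exchange (h : H.IsMaximumInvolution m) (hu : m u = u) (hx : m x ≠ x) (hxu : H.Adj x u) :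
    H.IsMaximumInvolution
      (fun w ↦ if w = u then x else if w = x then u else if w = m x then m x else m w) := by
  have hs' := hxu.symm
  obtain ⟨h1, h2⟩ := h.1
  refine ⟨⟨fun w ↦ by grind, fun w ↦ by grind⟩, fun m' h' ↦ le_trans (le_of_eq ?_) (h.2 m' h')⟩
  have hu' : u ∈ ({w | m w = w} : Finset W) := by simpa using hu
  have hmx : m x ∉ ({w | m w = w} : Finset W).erase u := by simp [h1, hx.symm]
  rw [← card_erase_add_one hu', ← card_insert_of_notMem hmx]
  congr 1
  ext w
  simp only [mem_filter, mem_univ, true_and, mem_insert, mem_erase]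
  grind

lemma not_adj_partner_partner (h : H.IsMaximumInvolution m) (hu : m u = u) (hv : m v = v)
    (huv : u ≠ v) (hx : m x ≠ x) (hz : m z ≠ z) (hzx : z ≠ x) (hzm : z ≠ m x)
    (hxu : H.Adj x u) (hzv : H.Adj z v) : ¬ H.Adj (m x) (m z) := by
  intro ha
  have h1 := h.1.1
  have := (h.exchange hu hx hxu).not_adj_partner (u := v) (v := m x) (x := z)
    (by grind) (by grind) (by grind) (by grind) hzv
  have hzu : z ≠ u := by grind
  simp only [hzu, hzx, hzm, if_false] at this
  exact this ha.symm

lemma not_adj_of_adj_partners (h : H.IsMaximumInvolution m) {x' : W} (hu : m u = u) (hv : m v = v)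
    (huv : u ≠ v) (hx : m x ≠ x) (hx' : m x' ≠ x') (hz : m z ≠ z) (hxx' : x ≠ x')
    (hxm : x' ≠ m x) (hzx : z ≠ x) (hzm : z ≠ m x) (hzx' : z ≠ x') (hzm' : z ≠ m x')
    (hxu : H.Adj x u) (hxv : H.Adj x' v) (hzy : H.Adj z (m x)) : ¬ H.Adj (m z) (m x') := by
  intro ha
  have h1 := h.1.1
  have := (h.exchange hu hx hxu).not_adj_partner_partner (u := m x) (v := v) (x := z) (z := x')
    (by grind) (by grind) (by grind) (by grind) (by grind) (by grind) (by grind) hzy hxv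
  have hzu : z ≠ u := by grind
  have hxu' : x' ≠ u := by grind
  simp only [hzu, hzx, hzm, hxu', hxx'.symm, hxm, if_false] at this
  exact this ha

end IsMaximumInvolution

/-- The quantitative form of the Erdős–Gallai theorem on matchings: a maximum matching splits into
`a` edges having an endpoint with two unmatched neighbours, and edges covering `b` further
vertices. -/
lemma IsMaximumInvolution.exists_adjCount_le {H : SimpleGraph W} [DecidableRel H.Adj] {m : W → W}
    (h : H.IsMaximumInvolution m) :
    ∃ a b : ℕ, #{v | m v ≠ v} = 2 * a + b ∧ 2 * a + b ≤ Fintype.card W ∧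
      H.adjCount univ univ + a + b ≤ a * a + b * b + 2 * (a * b) +
        2 * (a * (Fintype.card W - a - b)) + b * max 2 (a + 1) := by
  have hinv := h.1.1
  let U : Finset W := {v | m v = v}
  let X : Finset W := {v | m v ≠ v ∧ 2 ≤ #{q ∈ U | H.Adj v q}}
  let Y : Finset W := X.image m
  let B : Finset W := {v | m v ≠ v ∧ v ∉ X ∧ v ∉ Y}
  have hinj : Function.Injective m := fun p q hpq ↦ by rw [← hinv p, hpq, hinv]
  have memU : ∀ v, v ∈ U ↔ m v = v := by simp [U]
  have memX : ∀ v, v ∈ X → m v ≠ v := fun v hv ↦ (mem_filter.1 hv).2.1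
  have memY : ∀ v, v ∈ Y ↔ m v ∈ X := fun v ↦ by
    simp only [Y, mem_image]
    exact ⟨by rintro ⟨x, hx, rfl⟩; rwa [hinv], fun hv ↦ ⟨_, hv, hinv v⟩⟩
  have memB : ∀ v, v ∈ B ↔ m v ≠ v ∧ v ∉ X ∧ m v ∉ X := fun v ↦ by simp [B, memY]
  have nbr : ∀ x ∈ X, ∀ w, ∃ u, m u = u ∧ H.Adj x u ∧ u ≠ w := fun x hx w ↦ by
    obtain ⟨u, hu, huw⟩ := exists_mem_ne (mem_filter.1 hx).2.2 w
    rw [mem_filter, memU] at hu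
    exact ⟨u, hu.1, hu.2, huw⟩
  have partner : ∀ x ∈ X, ∀ u, m u = u → ¬ H.Adj (m x) u := fun x hx u hu ↦ by
    obtain ⟨u', hu', hadj, hne⟩ := nbr x hx u
    exact h.not_adj_partner hu' hu hne (memX x hx) hadj
  have hXY : ∀ v ∈ X, m v ∉ X := fun v hv hmv ↦ by
    obtain ⟨u, hu, hadj, -⟩ := nbr _ hmv v
    exact partner v hv u hu hadj
  have partners : ∀ x ∈ X, ∀ x' ∈ X, ¬ H.Adj (m x) (m x') := fun x hx x' hx' hadj ↦ by
    obtain ⟨u, hu, hxu, -⟩ := nbr x hx x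
    obtain ⟨v, hv, hxv, hvu⟩ := nbr x' hx' u
    refine h.not_adj_partner_partner hu hv hvu.symm (memX x hx) (memX x' hx') ?_ ?_ hxu hxv hadj
    · rintro rfl
      exact hadj.ne rfl
    · rintro rfl
      exact hXY x hx hx'
  have dUY : Disjoint U Y := Finset.disjoint_left.2 fun v hv hv' ↦ by grind
  have dXB : Disjoint X B := Finset.disjoint_left.2 fun v hv hv' ↦ by grind
  have dXBW : Disjoint (X ∪ B) (U ∪ Y) := Finset.disjoint_left.2 fun v hv hv' ↦ by grind
  have cover : (univ : Finset W) = X ∪ B ∪ (U ∪ Y) := by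
    ext v
    simp only [mem_univ, mem_union, true_iff]
    grind
  have cY : #Y = #X := card_image_of_injective _ hinj
  have cW : #(U ∪ Y) = #U + #X := by rw [card_union_of_disjoint dUY, cY]
  have ctot : Fintype.card W = #X + #B + (#U + #X) := by
    rw [← card_univ, cover, card_union_of_disjoint dXBW, card_union_of_disjoint dXB, cW]
  have cmatched : #{v | m v ≠ v} = 2 * #X + #B := by
    have := card_filter_add_card_filter_not (s := (univ : Finset W)) (fun v ↦ m v = v)
    rw [card_univ, ctot] at this
    change #U + _ = _ at this
    simp only [ne_eq]
    omega
  have eWW : H.adjCount (U ∪ Y) (U ∪ Y) = 0 := by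
    refine sum_eq_zero fun p hp ↦ card_eq_zero.2 (filter_eq_empty_iff.2 fun q hq hadj ↦ ?_)
    rw [mem_union, memU, memY] at hp hq
    rcases hp with hp | hp <;> rcases hq with hq | hq
    · exact h.not_adj_of_fixed hp hq hadj
    · exact partner _ hq p hp (by rw [hinv]; exact hadj.symm)
    · exact partner _ hp q hq (by rwa [hinv])
    · exact partners _ hp _ hq (by rwa [hinv, hinv])
  have conflict : ∀ z ∈ B, ∀ p ∈ U ∪ Y, ∀ q ∈ U ∪ Y, H.Adj z p → H.Adj (m z) q → p = q := by
    have key : ∀ z ∈ B, ∀ p, m p = p → ∀ x ∈ X, H.Adj z p → ¬ H.Adj (m z) (m x) := by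
      intro z hz p hp x hx hzp
      obtain ⟨u, hu, hxu, hup⟩ := nbr x hx p
      rw [memB] at hz
      exact h.not_adj_partner_partner hp hu hup.symm hz.1 (memX x hx) (by grind) (by grind)
        hzp hxu
    intro z hz p hp q hq hzp hzq
    have hz' := (memB z).1 hz
    by_contra hpq
    rw [mem_union, memU, memY] at hp hq
    rcases hp with hp | hp <;> rcases hq with hq | hq
    · exact h.not_adj_partner hp hq hpq hz'.1 hzp hzq
    · exact key z hz p hp _ hq hzp (by rwa [hinv])
    · exact key (m z) ((memB _).2 (by grind)) q hq _ hp hzq (by rwa [hinv, hinv])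
    · obtain ⟨u, hu, hxu, -⟩ := nbr _ hp p
      obtain ⟨v, hv, hxv, hvu⟩ := nbr _ hq u
      exact h.not_adj_of_adj_partners hu hv hvu.symm (memX _ hp) (memX _ hq) hz'.1
        (hinj.ne hpq) (by grind) (by grind) (by grind) (by grind) (by grind) hxu hxv
        (by rwa [hinv]) (by rwa [hinv])
  have degB : ∀ z ∈ B, #{q ∈ U ∪ Y | H.Adj z q} ≤ #X + 1 := fun z hz ↦ by
    rw [filter_union]
    have h1 : #{q ∈ U | H.Adj z q} ≤ 1 := by
      rw [memB] at hz
      by_contra! hlt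
      exact hz.2.1 (mem_filter.2 ⟨mem_univ _, hz.1, hlt⟩)
    have h2 : #{q ∈ Y | H.Adj z q} ≤ #X := (card_filter_le _ _).trans cY.le
    exact (card_union_le _ _).trans (by omega)
  have pairB : ∀ z ∈ B,
      #{q ∈ U ∪ Y | H.Adj z q} + #{q ∈ U ∪ Y | H.Adj (m z) q} ≤ max 2 (#X + 1) := by
    intro z hz
    have hmz : m z ∈ B := (memB _).2 (by grind)
    rcases eq_empty_or_nonempty {q ∈ U ∪ Y | H.Adj z q} with h0 | ⟨p, hp⟩
    · rw [h0, card_empty, zero_add]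
      exact (degB _ hmz).trans (le_max_right _ _)
    rcases eq_empty_or_nonempty {q ∈ U ∪ Y | H.Adj (m z) q} with h0 | ⟨q, hq⟩
    · rw [h0, card_empty, add_zero]
      exact (degB _ hz).trans (le_max_right _ _)
    have : Nonempty W := ⟨z⟩
    rw [mem_filter] at hp hq
    have h1 : #{q ∈ U ∪ Y | H.Adj z q} ≤ 1 := card_le_one_iff_subset_singleton.2 ⟨q, fun r hr ↦ by
      rw [mem_filter] at hr
      exact mem_singleton.2 (conflict z hz r hr.1 q hq.1 hr.2 hq.2)⟩
    have h2 : #{q ∈ U ∪ Y | H.Adj (m z) q} ≤ 1 :=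
      card_le_one_iff_subset_singleton.2 ⟨p, fun r hr ↦ by
        rw [mem_filter] at hr
        exact mem_singleton.2 (conflict z hz p hp.1 r hr.1 hp.2 hr.2).symm⟩
    exact le_trans (by omega) (le_max_left _ _)
  have eBW : 2 * H.adjCount B (U ∪ Y) ≤ #B * max 2 (#X + 1) := by
    have hswap : ∑ z ∈ B, #{q ∈ U ∪ Y | H.Adj (m z) q} = H.adjCount B (U ∪ Y) :=
      sum_nbij' m m (fun z hz ↦ (memB _).2 (by grind)) (fun z hz ↦ (memB _).2 (by grind))
        (fun z _ ↦ hinv z) (fun z _ ↦ hinv z) fun _ _ ↦ rfl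
    have := sum_le_card_nsmul B _ _ pairB
    rw [sum_add_distrib, hswap, smul_eq_mul] at this
    rw [two_mul]
    exact this
  refine ⟨#X, #B, cmatched, by omega, ?_⟩
  have eXX := H.adjCount_self_le X
  have eBB := H.adjCount_self_le B
  have eXB := H.adjCount_le X B
  have eXW := H.adjCount_le X (U ∪ Y)
  have hsub : Fintype.card W - #X - #B = #(U ∪ Y) := by omega
  rw [hsub, cover]
  simp only [adjCount_union_left _ dXBW, adjCount_union_left _ dXB, adjCount_union_right _ dXBW,
    adjCount_union_right _ dXB, eWW, H.adjCount_comm B X, H.adjCount_comm (U ∪ Y) X,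
    H.adjCount_comm (U ∪ Y) B]
  omega

/-- The edge set of a matching involution has at least half as many edges as there are matched
vertices. -/
lemma IsMatchingInvolution.exists_edges {H : SimpleGraph W} {m : W → W}
    (h : H.IsMatchingInvolution m) :
    ∃ M : Finset (Sym2 W), #{v | m v ≠ v} ≤ 2 * #M ∧ (∀ e ∈ M, e ∈ H.edgeSet) ∧
      ∀ e ∈ M, ∀ e' ∈ M, e ≠ e' → ∀ v : W, v ∈ e → v ∉ e' := by
  obtain ⟨h1, h2⟩ := h
  refine ⟨({v | m v ≠ v} : Finset W).image fun v ↦ s(v, m v), ?_, ?_, ?_⟩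
  · refine card_le_mul_card_image _ _ fun e he ↦ ?_
    obtain ⟨v, -, rfl⟩ := mem_image.1 he
    refine (card_le_card (t := {v, m v}) fun w hw ↦ ?_).trans card_le_two
    have := (mem_filter.1 hw).2
    simp only [Sym2.eq_iff] at this
    grind
  · intro e he
    obtain ⟨v, hv, rfl⟩ := mem_image.1 he
    exact h2 v (mem_filter.1 hv).2
  · intro e he e' he' hne v hv hv'
    obtain ⟨p, -, rfl⟩ := mem_image.1 he
    obtain ⟨q, -, rfl⟩ := mem_image.1 he'
    simp only [Sym2.mem_iff] at hv hv'
    rw [ne_eq, Sym2.eq_iff] at hne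
    grind

lemma ConnectedComponent.card_filter_induce_adj {V : Type*} [Fintype V] (G : SimpleGraph V)
    [DecidableRel G.Adj] (c : G.ConnectedComponent) [Fintype c.supp] (v : c.supp) :
    #{q : c.supp | (G.induce c.supp).Adj v q} = G.degree v := by
  rw [← card_neighborFinset_eq_degree]
  refine card_nbij Subtype.val (fun q hq ↦ by simpa using hq) Subtype.val_injective.injOn
    fun q hq ↦ ?_
  have hadj : G.Adj v q := by simpa using hq
  exact ⟨⟨q, (c.mem_supp_congr_adj hadj).1 v.2⟩, by simpa using hadj, rfl⟩

lemma ConnectedComponent.degree_add_one_le {V : Type*} [Fintype V] (G : SimpleGraph V)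
    [DecidableRel G.Adj] (v : V) : G.degree v + 1 ≤ (G.connectedComponentMk v).supp.ncard := by
  classical
  rw [← card_neighborFinset_eq_degree, ← card_insert_of_notMem (G.notMem_neighborFinset_self v),
    ← Set.ncard_coe_finset]
  refine Set.ncard_le_ncard (fun w hw ↦ ?_) (Set.toFinite _)
  have hw : w = v ∨ G.Adj v w := by simpa using hw
  rcases hw with rfl | hw
  · exact connectedComponentMk_mem
  · exact ConnectedComponent.sound hw.symm.reachable

/-- If a component on `m` vertices is largest, then the component and the remaining vertices carry
at most the stated numbers of edges. -/
lemma ConnectedComponent.two_mul_card_edgeFinset_le {V : Type*} [Fintype V] (G : SimpleGraph V)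
    [DecidableRel G.Adj] (c : G.ConnectedComponent) [Fintype c.supp]
    (hc : ∀ c' : G.ConnectedComponent, c'.supp.ncard ≤ c.supp.ncard) :
    ∃ r, 2 * #G.edgeFinset = (G.induce c.supp).adjCount univ univ + r ∧
      r + (Fintype.card V - Fintype.card c.supp) ≤
        (Fintype.card V - Fintype.card c.supp) * Fintype.card c.supp ∧
      r + (Fintype.card V - Fintype.card c.supp) ≤
        (Fintype.card V - Fintype.card c.supp) * (Fintype.card V - Fintype.card c.supp) := by
  classical
  have hcard : #c.supp.toFinsetᶜ = Fintype.card V - Fintype.card c.supp := by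
    rw [card_compl, Set.toFinset_card]
  refine ⟨∑ v ∈ c.supp.toFinsetᶜ, G.degree v, ?_, ?_, ?_⟩
  · rw [← G.sum_degrees_eq_twice_card_edges, ← sum_add_sum_compl c.supp.toFinset]
    congr 1
    rw [adjCount, sum_congr rfl fun v _ ↦ c.card_filter_induce_adj G v]
    exact (sum_subtype _ (fun v ↦ Set.mem_toFinset) fun v ↦ G.degree v)
  · rw [← hcard, card_eq_sum_ones, ← sum_add_distrib, ← card_eq_sum_ones, ← smul_eq_mul]
    refine sum_le_card_nsmul _ _ _ fun v _ ↦ (degree_add_one_le G v).trans ((hc _).trans ?_)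
    rw [Set.ncard_eq_toFinset_card', Set.toFinset_card]
  · rw [← hcard]
    nth_rw 1 [card_eq_sum_ones]
    rw [← sum_add_distrib, ← smul_eq_mul]
    refine sum_le_card_nsmul _ _ _ fun v hv ↦ ?_
    rw [← card_neighborFinset_eq_degree, ← card_insert_of_notMem (G.notMem_neighborFinset_self v)]
    refine card_le_card (insert_subset hv fun w hw ↦ ?_)
    have hadj : G.Adj v w := by simpa using hw
    simp only [mem_compl, Set.mem_toFinset] at hv ⊢
    rwa [← c.mem_supp_congr_adj hadj]

end SimpleGraph

/-- The maximum of the two extremal values in the Erdős–Gallai theorem bounds the intermediate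
ones. -/
lemma matching_bound_le_max {a b m d : ℝ} (ha : 0 ≤ a) (hb : 0 ≤ b)
    (h : d + a + b ≤ a * a + b * b + 2 * (a * b) + 2 * (a * (m - a - b)) + b * max 2 (a + 1))
    (ha1 : a = 0 ∨ 1 ≤ a) :
    d ≤ (2 * a + b) * (2 * a + b + 1) ∨
      4 * d ≤ (2 * a + b) * (4 * m - (2 * a + b) - 2) := by
  rcases ha1 with rfl | ha1
  · left
    norm_num at h ⊢
    nlinarith
  · rw [max_eq_right (by linarith)] at h
    by_cases hm : 4 * m - 2 ≤ 5 * (2 * a + b)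
    · left
      nlinarith [mul_nonneg ha hb, mul_nonneg ha (sub_nonneg.2 hm)]
    · right
      push Not at hm
      nlinarith [mul_nonneg hb (sub_nonneg.2 hm.le), mul_nonneg ha hb]

lemma component_matched_lower_bound {k m s d r : ℝ} (hk : 1 ≤ k) (hm0 : 0 ≤ m) (hm : m ≤ 3 * k)
    (hs0 : 0 ≤ s) (hsm : s ≤ m) (hsk : s ≤ 2 * k - 1) (hint : m ≤ 2 * k - 1 ∨ 2 * k ≤ m)
    (hd : d + m ≤ m * m) (hr : r + (3 * k - m) ≤ (3 * k - m) * m)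
    (hr' : r + (3 * k - m) ≤ (3 * k - m) * (3 * k - m))
    (hd' : d ≤ s * (s + 1) ∨ 4 * d ≤ s * (4 * m - s - 2)) :
    3 * (d + r) ≤ 5 * k * (3 * k - 1) := by
  by_contra! hlt
  have hm53 : 5 * k < 3 * m := by nlinarith
  rcases hint with hm2 | hm2
  · nlinarith [mul_nonneg (sub_nonneg.2 hm2) (by linarith : 0 ≤ m - 3 / 2 * k)]
  · rcases hd' with hd' | hd'
    · have h1 : s * (s + 1) ≤ (2 * k - 1) * (2 * k) := by nlinarith
      have h2 : (3 * k - m) * (3 * k - m) - (3 * k - m) ≤ k * k := by nlinarith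
      nlinarith
    · have h1 : s * (4 * m - s - 2) ≤ (2 * k - 1) * (4 * m - 2 * k - 1) := by nlinarith
      nlinarith [mul_nonneg (sub_nonneg.2 hm2) (sub_nonneg.2 hm)]

/-- **Lemma (graphmeet (iii)).** If `3 ∣ n` and `G` is a graph on `n` vertices with more than
`(5/9)·(n choose 2)` edges, then any connected component of `G` with the largest number of
vertices contains a matching of size `n/3`: there are `n/3` pairwise disjoint edges of `G`
all of whose vertices lie in that component. -/
theorem largest_component_has_matching {V : Type} [Fintype V] (n : ℕ)
    (hn : Fintype.card V = n) (h3 : 3 ∣ n) (G : SimpleGraph V)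
    (he : (5 : ℝ) / 9 * (n.choose 2) < (G.edgeSet.ncard : ℝ))
    (c : G.ConnectedComponent)
    (hc : ∀ c' : G.ConnectedComponent, c'.supp.ncard ≤ c.supp.ncard) :
    ∃ M : Finset (Sym2 V), M.card = n / 3 ∧
      (∀ e ∈ M, e ∈ G.edgeSet) ∧
      (∀ e ∈ M, ∀ v ∈ e, v ∈ c.supp) ∧
      (∀ e ∈ M, ∀ e' ∈ M, e ≠ e' → ∀ v : V, v ∈ e → v ∉ e') := by
  classical
  obtain ⟨k, rfl⟩ := h3
  let H := G.induce c.supp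
  obtain ⟨m, hm⟩ := H.exists_isMaximumInvolution
  obtain ⟨a, b, hab, habm, hbound⟩ := hm.exists_adjCount_le
  obtain ⟨M, hMcard, hMH, hMdisj⟩ := hm.1.exists_edges
  obtain ⟨r, hE, hr, hr'⟩ := c.two_mul_card_edgeFinset_le G hc
  have hle : Fintype.card c.supp ≤ Fintype.card V := Fintype.card_subtype_le _
  have hd := H.adjCount_self_le univ
  have hpos : 0 < Fintype.card V := Fintype.card_pos_iff.2 ⟨c.out⟩
  rw [hn] at hr hr' hle hpos
  rw [card_univ] at hd
  have hkM : k ≤ #M := by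
    by_contra! hlt
    rw [← SimpleGraph.coe_edgeFinset, Set.ncard_coe_finset, Nat.cast_choose_two] at he
    have hb := matching_bound_le_max (a := a) (b := b) (m := Fintype.card c.supp)
      (d := H.adjCount univ univ) (by positivity) (by positivity)
      (by
        have h1 : ((Fintype.card c.supp - a - b : ℕ) : ℝ) = Fintype.card c.supp - a - b := by
          rw [Nat.cast_sub (by omega), Nat.cast_sub (by omega)]
        rw [← h1]
        exact_mod_cast hbound)
      (by
        rcases Nat.eq_zero_or_pos a with h | h
        · exact .inl (by exact_mod_cast h)
        · exact .inr (by exact_mod_cast h))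
    have hint : (Fintype.card c.supp : ℝ) ≤ 2 * k - 1 ∨ 2 * (k : ℝ) ≤ Fintype.card c.supp := by
      rcases Nat.lt_or_ge (Fintype.card c.supp) (2 * k) with h | h
      · left
        rw [le_sub_iff_add_le]
        exact_mod_cast h
      · exact .inr (by exact_mod_cast h)
    have hs : 2 * (a : ℝ) + b ≤ 2 * k - 1 := by
      rw [le_sub_iff_add_le]
      exact_mod_cast (show 2 * a + b + 1 ≤ 2 * k by omega)
    have hsub : ((3 * k - Fintype.card c.supp : ℕ) : ℝ) = 3 * k - Fintype.card c.supp := by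
      rw [Nat.cast_sub hle]
      push_cast
      ring
    have := component_matched_lower_bound (k := k) (m := Fintype.card c.supp) (s := 2 * a + b)
      (d := H.adjCount univ univ) (r := r) (by exact_mod_cast (show 1 ≤ k by omega))
      (by positivity) (by exact_mod_cast hle) (by positivity) (by exact_mod_cast habm) hs hint
      (by exact_mod_cast hd) (by rw [← hsub]; exact_mod_cast hr)
      (by rw [← hsub]; exact_mod_cast hr') hb
    have hE' : 2 * (#G.edgeFinset : ℝ) = H.adjCount univ univ + r := by exact_mod_cast hE
    push_cast at he
    nlinarith
  obtain ⟨N, hNM, hN⟩ := exists_subset_card_eq hkM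
  refine ⟨N.map (Function.Embedding.subtype _).sym2Map, by rw [card_map, hN]; omega, ?_, ?_, ?_⟩
  · intro e he
    obtain ⟨f, hf, rfl⟩ := mem_map.1 he
    have := hMH f (hNM hf)
    induction f with | h p q => simpa [H] using this
  · intro e he v hv
    obtain ⟨f, hf, rfl⟩ := mem_map.1 he
    obtain ⟨w, -, rfl⟩ := Sym2.mem_map.1 hv
    exact w.2
  · intro e he e' he' hne v hv hv'
    obtain ⟨f, hf, rfl⟩ := mem_map.1 he
    obtain ⟨f', hf', rfl⟩ := mem_map.1 he'
    obtain ⟨w, hw, rfl⟩ := Sym2.mem_map.1 hv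
    obtain ⟨w', hw', hww'⟩ := Sym2.mem_map.1 hv'
    obtain rfl := Subtype.val_injective hww'
    exact hMdisj f (hNM hf) f' (hNM hf') (fun h ↦ hne (by rw [h])) _ hw hw'
end

section
/- Let n be a natural number divisible by 3 and let H be a 3-uniform hypergraph on n vertices with minimum vertex degree δ(H) > (5/9)·(n choose 2). Then H has a tightly connected spanning subhypergraph H′ (a subhypergraph on the same vertex set) with minimum vertex degree δ(H′) ≥ (4/9)·(n choose 2). -/
/-- There is a tight walk in the hypergraph with edge set `E` from the edge `e` to the
edge `e'`: a sequence of (not necessarily distinct) edges starting at `e` and ending at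
`e'` in which consecutive edges intersect in exactly two vertices. -/
def HasTightWalk {V : Type} [DecidableEq V] (E : Finset (Finset V))
    (e e' : Finset V) : Prop :=
  ∃ (ℓ : ℕ) (f : ℕ → Finset V), f 0 = e ∧ f ℓ = e' ∧ (∀ i ≤ ℓ, f i ∈ E) ∧
    ∀ i < ℓ, (f i ∩ f (i + 1)).card = 2

open scoped Classical in
/-- The number of ordered pairs related by `L`, as a real number. -/
noncomputable def pairCount {V : Type} [Fintype V] (L : V → V → Prop) : ℝ :=
  ∑ x, ∑ y, if L x y then (1 : ℝ) else 0

section PairCount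

open scoped Classical

variable {V : Type} [Fintype V]

theorem sum_ite_mem_eq_card (S : Finset V) :
    ∑ x, (if x ∈ S then (1 : ℝ) else 0) = S.card := by
  simp

theorem sum_ite_notMem_eq (S : Finset V) :
    ∑ x, (if x ∈ S then (0 : ℝ) else 1) = Fintype.card V - S.card := by
  have h : ∀ x, (if x ∈ S then (0 : ℝ) else 1) = 1 - (if x ∈ S then (1 : ℝ) else 0) := by
    intro x; split_ifs <;> simp
  simp only [h, Finset.sum_sub_distrib, sum_ite_mem_eq_card]
  simp

theorem sum_sum_ite_eq :
    ∑ x : V, ∑ y : V, (if x = y then (1 : ℝ) else 0) = Fintype.card V := by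
  simp

/-- An irreflexive relation with no pairs between `S` and its complement has at most
`s² + (n - s)² - n` pairs, where `s` is the size of `S` and `n` that of the vertex set. -/
theorem pairCount_le_of_closed {L : V → V → Prop} (hirr : ∀ x, ¬ L x x) {S : Finset V}
    (hS : ∀ x y, L x y → (x ∈ S ↔ y ∈ S)) :
    pairCount L ≤ (S.card : ℝ) ^ 2 + (Fintype.card V - S.card : ℝ) ^ 2 - Fintype.card V := by
  have key : pairCount L ≤ ∑ x : V, ∑ y : V,
      ((if x ∈ S then (1 : ℝ) else 0) * (if y ∈ S then (1 : ℝ) else 0)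
        + (if x ∈ S then (0 : ℝ) else 1) * (if y ∈ S then (0 : ℝ) else 1)
        - (if x = y then (1 : ℝ) else 0)) := by
    refine Finset.sum_le_sum fun x _ => Finset.sum_le_sum fun y _ => ?_
    have h1 := hS x y
    have h2 := hirr x
    by_cases hxy : x = y
    · subst hxy
      by_cases hx : x ∈ S <;> simp [h2, hx]
    · by_cases hL : L x y <;> by_cases hx : x ∈ S <;> by_cases hy : y ∈ S <;>
        simp_all
  simp only [Finset.sum_sub_distrib, Finset.sum_add_distrib, ← Finset.sum_mul_sum,
    sum_ite_mem_eq_card, sum_ite_notMem_eq, sum_sum_ite_eq] at key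
  linarith

/-- The pairs inside a closed set `S` are all but those in the complement of `S`. -/
theorem pairCount_le_add_of_closed {L : V → V → Prop} {S : Finset V}
    (hS : ∀ x y, L x y → (x ∈ S ↔ y ∈ S)) :
    pairCount L ≤ pairCount (fun x y => L x y ∧ x ∈ S) +
      (Fintype.card V - S.card : ℝ) ^ 2 := by
  have key : pairCount L ≤ ∑ x : V, ∑ y : V,
      ((if L x y ∧ x ∈ S then (1 : ℝ) else 0)
        + (if x ∈ S then (0 : ℝ) else 1) * (if y ∈ S then (0 : ℝ) else 1)) := by
    refine Finset.sum_le_sum fun x _ => Finset.sum_le_sum fun y _ => ?_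
    have h1 := hS x y
    by_cases hL : L x y <;> by_cases hx : x ∈ S <;> by_cases hy : y ∈ S <;>
        simp_all
  simp only [Finset.sum_add_distrib, ← Finset.sum_mul_sum, sum_ite_notMem_eq] at key
  rw [pairCount] at key
  rw [pairCount, pairCount, sq]
  convert key using 6

/-- A relation with more than `5/9` of all pairs has a component covering more than two thirds
of the vertices. -/
theorem exists_large_component {L : V → V → Prop} (hsymm : ∀ x y, L x y → L y x)
    (hirr : ∀ x, ¬ L x x) {k : ℕ} (hk : 1 ≤ k) (hV : Fintype.card V = 3 * k)
    (hL : (5 : ℝ) / 9 * (3 * k * (3 * k - 1)) < pairCount L) :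
    ∃ S : Finset V, 2 * k + 1 ≤ S.card ∧ (∀ x y, L x y → (x ∈ S ↔ y ∈ S)) ∧
      ∀ x ∈ S, ∀ y ∈ S, Relation.ReflTransGen L x y := by
  have hk' : (1 : ℝ) ≤ k := by exact_mod_cast hk
  have hVr : (Fintype.card V : ℝ) = 3 * k := by exact_mod_cast hV
  have : Std.Symm L := ⟨hsymm⟩
  have hgsymm : ∀ x y, Relation.ReflTransGen L x y → Relation.ReflTransGen L y x :=
    fun x y h => symm_of (Relation.ReflTransGen L) h
  obtain ⟨r, hr⟩ : ∃ r, (5 : ℝ) / 9 * (3 * k - 1) < ∑ y, if L r y then (1 : ℝ) else 0 := by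
    by_contra! hcon
    have h := Finset.sum_le_card_nsmul Finset.univ _ _ fun x _ => hcon x
    rw [Finset.card_univ, nsmul_eq_mul, hVr] at h
    rw [pairCount] at hL
    linarith
  set S : Finset V := Finset.univ.filter fun y => Relation.ReflTransGen L r y with hSdef
  have hmem : ∀ y, y ∈ S ↔ Relation.ReflTransGen L r y := by simp [hSdef]
  have hclosed : ∀ x y, L x y → (x ∈ S ↔ y ∈ S) := fun x y h => by
    rw [hmem, hmem]
    exact ⟨fun hx => hx.tail h, fun hy => hy.tail (hsymm _ _ h)⟩
  refine ⟨S, ?_, hclosed, fun x hx y hy =>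
    (hgsymm _ _ ((hmem x).1 hx)).trans ((hmem y).1 hy)⟩
  have hdeg : ∑ y, (if L r y then (1 : ℝ) else 0) ≤ S.card - 1 := by
    have h1 : ∑ y, (if L r y then (1 : ℝ) else 0) ≤
        ∑ y, ((if y ∈ S then (1 : ℝ) else 0) - (if r = y then (1 : ℝ) else 0)) := by
      refine Finset.sum_le_sum fun y _ => ?_
      by_cases hry : r = y
      · subst hry
        have : r ∈ S := (hmem r).2 .refl
        simp [hirr, this]
      · by_cases hLy : L r y
        · have : y ∈ S := (hmem y).2 (.single hLy)
          simp [hLy, hry, this]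
        · simp only [hLy, hry, if_false]
          split_ifs <;> norm_num
    rw [Finset.sum_sub_distrib, sum_ite_mem_eq_card] at h1
    simpa using h1
  have hle := pairCount_le_of_closed hirr hclosed
  rw [hVr] at hle
  by_contra! hlt
  have hs : (S.card : ℝ) ≤ 2 * k := by exact_mod_cast Nat.lt_succ_iff.1 hlt
  nlinarith [mul_nonneg (sub_nonneg.2 hs) (show (0 : ℝ) ≤ S.card - k by linarith)]

/-- Two relations, each with more than `5/9` of all pairs, have a common pair inside any two
closed sets covering more than two thirds of the vertices. -/
theorem exists_common_pair {L M : V → V → Prop} (hLirr : ∀ x, ¬ L x x)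
    (hMirr : ∀ x, ¬ M x x) {k : ℕ} (hk : 1 ≤ k) (hV : Fintype.card V = 3 * k)
    (hL : (5 : ℝ) / 9 * (3 * k * (3 * k - 1)) < pairCount L)
    (hM : (5 : ℝ) / 9 * (3 * k * (3 * k - 1)) < pairCount M) {S T : Finset V}
    (hS : ∀ x y, L x y → (x ∈ S ↔ y ∈ S)) (hT : ∀ x y, M x y → (x ∈ T ↔ y ∈ T))
    (hSc : 2 * k + 1 ≤ S.card) (hTc : 2 * k + 1 ≤ T.card) :
    ∃ x y, L x y ∧ M x y ∧ x ∈ S ∧ x ∈ T := by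
  have hVr : (Fintype.card V : ℝ) = 3 * k := by exact_mod_cast hV
  by_contra! hcon
  have key : pairCount L + pairCount M ≤ ∑ x : V, ∑ y : V,
      ((1 : ℝ) - (if x = y then (1 : ℝ) else 0)
        + ((if x ∈ S then (1 : ℝ) else 0) - (if x ∈ T then (1 : ℝ) else 0)) *
          ((if y ∈ S then (1 : ℝ) else 0) - (if y ∈ T then (1 : ℝ) else 0))
        + (if x ∈ S ∪ T then (0 : ℝ) else 1) * (if y ∈ S ∪ T then (0 : ℝ) else 1)
        - (if x ∈ S ∪ T then (0 : ℝ) else 1) * (if y ∈ S ∩ T then (1 : ℝ) else 0)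
        - (if x ∈ S ∩ T then (1 : ℝ) else 0) * (if y ∈ S ∪ T then (0 : ℝ) else 1)) := by
    rw [pairCount, pairCount, ← Finset.sum_add_distrib]
    refine Finset.sum_le_sum fun x _ => ?_
    rw [← Finset.sum_add_distrib]
    refine Finset.sum_le_sum fun y _ => ?_
    have h1 := hS x y
    have h2 := hT x y
    have h3 := hcon x y
    simp only [Finset.mem_union, Finset.mem_inter]
    by_cases hxy : x = y
    · subst hxy
      by_cases hx : x ∈ S <;> by_cases hx' : x ∈ T <;> simp [hLirr, hMirr, hx, hx']
    · by_cases hx : x ∈ S <;> by_cases hx' : x ∈ T <;> by_cases hy : y ∈ S <;>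
        by_cases hy' : y ∈ T <;> by_cases hl : L x y <;> by_cases hm : M x y <;>
        simp [hx, hx', hy, hy', hl, hm] at h1 h2 h3 <;>
        simp [hx, hx', hy, hy', hl, hm, hxy]
  simp only [Finset.sum_sub_distrib, Finset.sum_add_distrib, ← Finset.sum_mul_sum,
    sum_ite_mem_eq_card, sum_ite_notMem_eq, sum_sum_ite_eq, Finset.sum_const,
    Finset.card_univ, nsmul_eq_mul, hVr, mul_one] at key
  have hk' : (1 : ℝ) ≤ k := by exact_mod_cast hk
  have hcard : ((S ∪ T).card : ℝ) + (S ∩ T).card = S.card + T.card := by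
    exact_mod_cast Finset.card_union_add_card_inter S T
  have hU : ((S ∪ T).card : ℝ) ≤ 3 * k := by
    rw [← hVr]; exact_mod_cast Finset.card_le_univ _
  have hS1 : (S.card : ℝ) ≤ (S ∪ T).card := by
    exact_mod_cast Finset.card_le_card Finset.subset_union_left
  have hT1 : (T.card : ℝ) ≤ (S ∪ T).card := by
    exact_mod_cast Finset.card_le_card Finset.subset_union_right
  have hSr : 2 * (k : ℝ) + 1 ≤ S.card := by exact_mod_cast hSc
  have hTr : 2 * (k : ℝ) + 1 ≤ T.card := by exact_mod_cast hTc
  have hd : 0 ≤ (3 * (k : ℝ) - (S ∪ T).card) *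
      (2 * (S ∩ T).card - (3 * (k : ℝ) - (S ∪ T).card)) :=
    mul_nonneg (by linarith) (by linarith)
  have hab : ((S.card : ℝ) - T.card) ^ 2 ≤ (k - 1 : ℝ) ^ 2 :=
    sq_le_sq' (by linarith) (by linarith)
  nlinarith

end PairCount

section TightWalk

variable {V : Type} [DecidableEq V]

/-- Two edges of `E` that intersect in exactly two vertices. -/
def TightAdj (E : Finset (Finset V)) (e e' : Finset V) : Prop :=
  e ∈ E ∧ e' ∈ E ∧ (e ∩ e').card = 2

theorem TightAdj.symm {E : Finset (Finset V)} {e e' : Finset V} (h : TightAdj E e e') :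
    TightAdj E e' e :=
  ⟨h.2.1, h.1, by rw [Finset.inter_comm]; exact h.2.2⟩

theorem HasTightWalk.of_reflTransGen {E : Finset (Finset V)} {e e' : Finset V} (he : e ∈ E)
    (h : Relation.ReflTransGen (TightAdj E) e e') : HasTightWalk E e e' := by
  induction h with
  | refl => exact ⟨0, fun _ => e, rfl, rfl, fun _ _ => he, by simp⟩
  | @tail b c _ hbc ih =>
    obtain ⟨l, f, h0, hl, hmem, hadj⟩ := ih
    refine ⟨l + 1, fun i => if i ≤ l then f i else c, by simpa using h0, by simp, ?_, ?_⟩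
    · intro i _
      by_cases h : i ≤ l
      · simpa [h] using hmem i h
      · simpa [h] using hbc.2.1
    · intro i hi
      rcases Nat.lt_succ_iff_lt_or_eq.1 hi with h | rfl
      · simpa [h.le, Nat.succ_le_of_lt h] using hadj i h
      · simpa [hl] using hbc.2.2

/-- The edges reachable from a fixed edge form a tightly connected hypergraph. -/
theorem HasTightWalk.of_component {E E' : Finset (Finset V)} {e₀ : Finset V}
    (hE' : ∀ e, e ∈ E' ↔ e ∈ E ∧ Relation.ReflTransGen (TightAdj E) e₀ e)
    {e e' : Finset V} (he : e ∈ E') (he' : e' ∈ E') : HasTightWalk E' e e' := by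
  have hrestrict : ∀ c, Relation.ReflTransGen (TightAdj E) e₀ c →
      Relation.ReflTransGen (TightAdj E') e₀ c := by
    intro c hc
    induction hc with
    | refl => exact .refl
    | @tail a b hab h ih =>
      exact ih.tail ⟨(hE' a).2 ⟨h.1, hab⟩, (hE' b).2 ⟨h.2.1, hab.tail h⟩, h.2.2⟩
  have : Std.Symm (TightAdj E') := ⟨fun _ _ => TightAdj.symm⟩
  have hs := symm_of (Relation.ReflTransGen (TightAdj E')) (hrestrict e ((hE' e).1 he).2)
  exact .of_reflTransGen he (hs.trans (hrestrict e' ((hE' e').1 he').2))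

variable {E : Finset (Finset V)}

theorem ne_of_card_triple {a b c : V} (h : ({a, b, c} : Finset V).card = 3) :
    a ≠ b ∧ a ≠ c ∧ b ≠ c := by
  have h1 := Finset.card_le_two (a := a) (b := b)
  have h2 := Finset.card_le_two (a := b) (b := c)
  refine ⟨?_, ?_, ?_⟩ <;> rintro rfl <;> simp at h <;> grind

theorem reflTransGen_of_common_pair (hE : ∀ e ∈ E, e.card = 3) {a b c d : V}
    (h : {a, b, c} ∈ E) (h' : {a, b, d} ∈ E) :
    Relation.ReflTransGen (TightAdj E) {a, b, c} {a, b, d} := by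
  by_cases hcd : c = d
  · subst hcd; exact .refl
  · refine .single ⟨h, h', ?_⟩
    obtain ⟨hab, hac, hbc⟩ := ne_of_card_triple (hE _ h)
    have : ({a, b, c} ∩ {a, b, d} : Finset V) = {a, b} := by
      ext x
      simp only [Finset.mem_inter, Finset.mem_insert, Finset.mem_singleton]
      grind
    rw [this, Finset.card_pair hab]

theorem reflTransGen_of_link_reachable (hE : ∀ e ∈ E, e.card = 3) {v x x' : V}
    (h : Relation.ReflTransGen (fun a b => ({v, a, b} : Finset V) ∈ E) x x') {y : V}
    (hy : {v, x, y} ∈ E) : ∀ {y' : V}, {v, x', y'} ∈ E →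
    Relation.ReflTransGen (TightAdj E) {v, x, y} {v, x', y'} := by
  induction h with
  | refl => exact fun hy' => reflTransGen_of_common_pair hE hy hy'
  | @tail b c _ hbc ih =>
    intro y' hy'
    have h1 := ih hbc
    rw [Finset.pair_comm b c] at h1 hbc
    exact h1.trans (reflTransGen_of_common_pair hE hbc hy')

theorem pairCount_link_eq [Fintype V] (hE : ∀ e ∈ E, e.card = 3) (v : V) :
    pairCount (fun x y => ({v, x, y} : Finset V) ∈ E) =
      2 * ((E.filter fun e => v ∈ e).card : ℝ) := by
  have h1 : pairCount (fun x y => ({v, x, y} : Finset V) ∈ E) =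
      (((Finset.univ : Finset (V × V)).filter
        fun p => ({v, p.1, p.2} : Finset V) ∈ E).card : ℝ) := by
    rw [pairCount, Finset.card_filter, ← Finset.univ_product_univ, Finset.sum_product]
    push_cast
    exact Finset.sum_congr rfl fun _ _ => Finset.sum_congr rfl fun _ _ => by congr
  have h2 : ((Finset.univ : Finset (V × V)).filter
      fun p => ({v, p.1, p.2} : Finset V) ∈ E).card =
      ∑ e ∈ E.filter (fun e => v ∈ e), 2 := by
    rw [Finset.card_eq_sum_card_fiberwise (f := fun p : V × V => ({v, p.1, p.2} : Finset V))
      (t := E.filter fun e => v ∈ e)]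
    · refine Finset.sum_congr rfl fun e he => ?_
      rw [Finset.mem_filter] at he
      have hc : (e.erase v).card = 2 := by
        rw [Finset.card_erase_of_mem he.2, hE e he.1]
      obtain ⟨a, b, hab, hec⟩ := Finset.card_eq_two.1 hc
      have hev : e = {v, a, b} := by rw [← hec, Finset.insert_erase he.2]
      have : ((Finset.univ.filter fun p : V × V => ({v, p.1, p.2} : Finset V) ∈ E).filter
          fun p => ({v, p.1, p.2} : Finset V) = e) = {(a, b), (b, a)} := by
        ext ⟨x, y⟩
        simp only [Finset.mem_filter, Finset.mem_univ, true_and, Finset.mem_insert,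
          Finset.mem_singleton, Prod.mk.injEq]
        constructor
        · rintro ⟨hxy, heq⟩
          obtain ⟨hvx, hvy, hxy'⟩ := ne_of_card_triple (hE _ hxy)
          have hx : x ∈ ({a, b} : Finset V) := by
            rw [← hec, ← heq]; simp [hvx.symm]
          have hy : y ∈ ({a, b} : Finset V) := by
            rw [← hec, ← heq]; simp [hvy.symm]
          simp only [Finset.mem_insert, Finset.mem_singleton] at hx hy
          grind
        · rintro (⟨rfl, rfl⟩ | ⟨rfl, rfl⟩)
          · exact ⟨hev ▸ he.1, hev.symm⟩
          · rw [Finset.pair_comm]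
            exact ⟨hev ▸ he.1, hev.symm⟩
      rw [this, Finset.card_pair]
      grind
    · intro p hp
      simp only [Finset.coe_filter, Finset.mem_univ, true_and, Set.mem_ofPred_eq] at hp ⊢
      exact ⟨hp, by simp⟩
  rw [h1, h2, Finset.sum_const, smul_eq_mul, Nat.cast_mul, mul_comm, Nat.cast_ofNat]

end TightWalk

/-- **Lemma (fracmatch (i)).** If `3 ∣ n` and `H` is a 3-graph on `n` vertices with minimum
vertex degree greater than `(5/9)·(n choose 2)`, then `H` has a tightly connected spanning
subhypergraph `H'` with minimum vertex degree at least `(4/9)·(n choose 2)`. -/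
theorem tightly_connected_spanning_subgraph {V : Type} [Fintype V] [DecidableEq V]
    (n : ℕ) (hn : Fintype.card V = n) (h3 : 3 ∣ n)
    (E : Finset (Finset V)) (hE : ∀ e ∈ E, e.card = 3)
    (hδ : ∀ v : V, (5 : ℝ) / 9 * (n.choose 2) < ((E.filter (fun e => v ∈ e)).card : ℝ)) :
    ∃ E' ⊆ E, (∀ e ∈ E', ∀ e' ∈ E', HasTightWalk E' e e') ∧
      ∀ v : V, (4 : ℝ) / 9 * (n.choose 2) ≤ ((E'.filter (fun e => v ∈ e)).card : ℝ) := by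
  classical
  obtain ⟨k, rfl⟩ := h3
  rcases isEmpty_or_nonempty V with hemp | ⟨⟨v₀⟩⟩
  · exact ⟨∅, by simp, by simp, fun v => isEmptyElim v⟩
  have hk : 1 ≤ k := by
    have : 0 < Fintype.card V := Fintype.card_pos_iff.2 ⟨v₀⟩
    omega
  have hchoose : (((3 * k).choose 2 : ℕ) : ℝ) = 3 * k * (3 * k - 1) / 2 := by
    rw [Nat.cast_choose_two]; push_cast; ring
  rw [hchoose] at hδ ⊢
  have hk' : (1 : ℝ) ≤ k := by exact_mod_cast hk
  have hnr : (Fintype.card V : ℝ) = 3 * k := by exact_mod_cast hn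
  have hsymm : ∀ v x y : V, ({v, x, y} : Finset V) ∈ E → ({v, y, x} : Finset V) ∈ E :=
    fun v x y h => by rwa [Finset.pair_comm]
  have hirr : ∀ v x : V, ({v, x, x} : Finset V) ∉ E :=
    fun v x h => (ne_of_card_triple (hE _ h)).2.2 rfl
  have hcount : ∀ v : V, (5 : ℝ) / 9 * (3 * k * (3 * k - 1)) <
      pairCount fun x y => ({v, x, y} : Finset V) ∈ E := by
    intro v
    rw [pairCount_link_eq hE]
    linarith [hδ v]
  choose S hScard hSclosed hSconn using fun v =>
    exists_large_component (hsymm v) (hirr v) hk hn (hcount v)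
  have hcommon := fun u v => exists_common_pair (hirr u) (hirr v) hk hn (hcount u) (hcount v)
    (hSclosed u) (hSclosed v) (hScard u) (hScard v)
  obtain ⟨x₀, y₀, he₀, -, hx₀, -⟩ := hcommon v₀ v₀
  set E' := E.filter fun e => Relation.ReflTransGen (TightAdj E) {v₀, x₀, y₀} e
  have hE' : ∀ e, e ∈ E' ↔ e ∈ E ∧ Relation.ReflTransGen (TightAdj E) {v₀, x₀, y₀} e :=
    fun e => Finset.mem_filter
  have hsub : E' ⊆ E := Finset.filter_subset _ _
  refine ⟨E', hsub, fun e he e' he' => .of_component hE' he he', fun v => ?_⟩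
  have hgood : ∀ x y, {v, x, y} ∈ E ∧ x ∈ S v → {v, x, y} ∈ E' := by
    rintro x y ⟨hxy, hx⟩
    obtain ⟨a, b, hab, hab', ha, ha'⟩ := hcommon v₀ v
    refine (hE' _).2 ⟨hxy, ?_⟩
    have h1 := reflTransGen_of_link_reachable hE (hSconn v₀ x₀ hx₀ a ha) he₀ hab
    have h2 : Relation.ReflTransGen (TightAdj E) {v₀, a, b} {v, a, b} := by
      have hr : ∀ w : V, ({w, a, b} : Finset V) = {a, b, w} := fun w => by
        ext z; simp only [Finset.mem_insert, Finset.mem_singleton]; tauto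
      rw [hr] at hab hab' ⊢
      rw [hr v]
      exact reflTransGen_of_common_pair hE hab hab'
    exact (h1.trans h2).trans
      (reflTransGen_of_link_reachable hE (hSconn v a ha' x hx) hab' hxy)
  have hmono : pairCount (fun x y => ({v, x, y} : Finset V) ∈ E ∧ x ∈ S v) ≤
      pairCount fun x y => ({v, x, y} : Finset V) ∈ E' := by
    refine Finset.sum_le_sum fun x _ => Finset.sum_le_sum fun y _ => ?_
    have := hgood x y
    by_cases h : ({v, x, y} : Finset V) ∈ E ∧ x ∈ S v
    · simp [h, this h]
    · simp only [h, if_false]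
      split_ifs <;> norm_num
  rw [pairCount_link_eq fun e he => hE e (hsub he)] at hmono
  have hle := pairCount_le_add_of_closed (hSclosed v)
  rw [hnr] at hle
  have hSr : 2 * (k : ℝ) + 1 ≤ (S v).card := by exact_mod_cast hScard v
  have hSr' : ((S v).card : ℝ) ≤ 3 * k := by
    rw [← hnr]; exact_mod_cast Finset.card_le_univ _
  have hsq : (3 * (k : ℝ) - (S v).card) ^ 2 ≤ (k - 1 : ℝ) ^ 2 :=
    sq_le_sq' (by linarith) (by linarith)
  nlinarith [hcount v]
end

section
/- Let n be a natural number divisible by 3 and let H be a 3-uniform hypergraph on n vertices such that for every vertex u, the link graph L(u) of u contains a matching of size n/3. Then H admits a perfect fractional matching; that is, there is an assignment of weights w_e ∈ [0,1] to the edges e of H such that for every vertex v the sum of w_e over edges e containing v is at most 1, and the total weight ∑_e w_e equals n/3. -/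
/-- If every linear functional takes on some edge in `E` a value at most its value at `c`, then `c`
is a convex combination of indicator vectors of edges in `E`. -/
theorem exists_convexWeights_of_forall_exists_sum_le {V : Type*} [Fintype V] [DecidableEq V]
    (E : Finset (Finset V)) (c : V → ℝ)
    (h : ∀ y : V → ℝ, ∃ e ∈ E, ∑ v ∈ e, y v ≤ ∑ v, c v * y v) :
    ∃ w ∈ stdSimplex ℝ E, ∀ v, (∑ e : E, if v ∈ e.1 then w e else 0) = c v := by
  let T : (E → ℝ) →ₗ[ℝ] (V → ℝ) :=
    { toFun := fun w v => ∑ e : E, if v ∈ e.1 then w e else 0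
      map_add' := fun x y => by
        ext v
        simp only [Pi.add_apply, ← Finset.sum_add_distrib]
        exact Finset.sum_congr rfl fun e _ => by split_ifs <;> simp
      map_smul' := fun a x => by
        ext v
        simp [Finset.mul_sum] }
  suffices hc : c ∈ T '' stdSimplex ℝ E by
    obtain ⟨w, hw, rfl⟩ := hc
    exact ⟨w, hw, fun _ => rfl⟩
  by_contra hc
  have hT : Continuous T := T.continuous_of_finiteDimensional
  obtain ⟨f, s, hfs, hs⟩ := geometric_hahn_banach_point_closed
    ((convex_stdSimplex ℝ E).linear_image T) ((isCompact_stdSimplex ℝ E).image hT).isClosed hc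
  have hf (x : V → ℝ) : f x = ∑ v, x v * f fun i => if v = i then 1 else 0 :=
    LinearMap.pi_apply_eq_sum_univ (f : (V → ℝ) →ₗ[ℝ] ℝ) x
  obtain ⟨e, he, hle⟩ := h fun v => f fun i => if v = i then 1 else 0
  have hse := hs _ ⟨_, single_mem_stdSimplex ℝ (⟨e, he⟩ : E), rfl⟩
  have hTe (v : V) : T (Pi.single ⟨e, he⟩ 1) v = if v ∈ e then 1 else 0 := by
    change (∑ e' : E, if v ∈ e'.1 then (Pi.single ⟨e, he⟩ 1 : E → ℝ) e' else 0) = _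
    rw [Finset.sum_eq_single ⟨e, he⟩ (fun e' _ hne => by simp [Pi.single_eq_of_ne hne])
      (by simp)]
    simp
  rw [hf] at hse hfs
  simp only [hTe, ite_mul, one_mul, zero_mul, Finset.sum_ite_mem, Finset.univ_inter] at hse
  linarith

/-- Averaging over a matching in the link of a vertex where `y` is minimal produces an edge on which
the sum of `y` is at most average. -/
theorem exists_mem_sum_le_of_link_matchings {V : Type*} [Fintype V] [DecidableEq V]
    {m : ℕ} (hm : 0 < m) (hV : Fintype.card V = 3 * m)
    (E : Finset (Finset V)) (hE : ∀ e ∈ E, e.card = 3)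
    (hlink : ∀ u : V, ∃ M : Finset (Finset V), M.card = m ∧
      (∀ p ∈ M, p.card = 2 ∧ insert u p ∈ E) ∧
      (∀ p ∈ M, ∀ q ∈ M, p ≠ q → Disjoint p q)) (y : V → ℝ) :
    ∃ e ∈ E, m * ∑ v ∈ e, y v ≤ ∑ v, y v := by
  have : Nonempty V := Fintype.card_pos_iff.mp (by omega)
  obtain ⟨u, hu⟩ := Finite.exists_min y
  obtain ⟨M, hMcard, hM, hdisj⟩ := hlink u
  by_contra! hlt
  have hnotMem : ∀ p ∈ M, u ∉ p := fun p hp hup => by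
    have h := hE _ (hM p hp).2
    rw [Finset.insert_eq_of_mem hup, (hM p hp).1] at h
    omega
  have hpair : (M : Set (Finset V)).PairwiseDisjoint id :=
    fun p hp q hq hne => hdisj p hp q hq hne
  have hcover : (M.biUnion id).card = 2 * m := by
    rw [Finset.card_biUnion hpair, ← hMcard, mul_comm]
    exact Finset.sum_const_nat fun p hp => (hM p hp).1
  have hcompl : (M.biUnion id)ᶜ.card = m := by
    rw [Finset.card_compl, hV, hcover]
    omega
  have hrest : m * y u ≤ ∑ v ∈ (M.biUnion id)ᶜ, y v := by
    simpa [hcompl] using Finset.card_nsmul_le_sum (M.biUnion id)ᶜ y (y u) fun v _ => hu v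
  have hsplit := Finset.sum_add_sum_compl (M.biUnion id) y
  rw [Finset.sum_biUnion hpair] at hsplit
  have hsum : ∑ p ∈ M, (∑ v, y v) < ∑ p ∈ M, m * (y u + ∑ v ∈ p, y v) := by
    refine Finset.sum_lt_sum_of_nonempty (Finset.card_pos.mp (by omega)) fun p hp => ?_
    rw [← Finset.sum_insert (hnotMem p hp)]
    exact hlt _ (hM p hp).2
  rw [← Finset.mul_sum, Finset.sum_add_distrib] at hsum
  simp only [Finset.sum_const, hMcard, nsmul_eq_mul] at hsum
  have hm' : (0 : ℝ) < m := by exact_mod_cast hm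
  have := lt_of_mul_lt_mul_left hsum hm'.le
  simp only [id] at hsplit
  linarith



/-- If `3 ∣ n` and `H` is a 3-uniform hypergraph on `n` vertices such that the link graph
of every vertex contains a matching of size `n/3`, then `H` admits a perfect fractional
matching: edge weights in `[0,1]`, total weight at most `1` at each vertex, and total
weight exactly `n/3`. -/
theorem perfect_fractional_matching_of_link_matchings {V : Type} [Fintype V] [DecidableEq V]
    (n : ℕ) (hn : Fintype.card V = n) (h3 : 3 ∣ n)
    (E : Finset (Finset V)) (hE : ∀ e ∈ E, e.card = 3)
    (hlink : ∀ u : V, ∃ M : Finset (Finset V), M.card = n / 3 ∧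
      (∀ p ∈ M, p.card = 2 ∧ insert u p ∈ E) ∧
      (∀ p ∈ M, ∀ q ∈ M, p ≠ q → Disjoint p q)) :
    ∃ w : Finset V → ℝ, (∀ e, 0 ≤ w e ∧ w e ≤ 1) ∧ (∀ e ∉ E, w e = 0) ∧
      (∀ v : V, ∑ e ∈ E.filter (fun e => v ∈ e), w e ≤ 1) ∧
      (∑ e ∈ E, w e = (n : ℝ) / 3) := by
  obtain ⟨m, rfl⟩ := h3
  rw [Nat.mul_div_cancel_left m (by norm_num)] at hlink
  have hcast : ((3 * m : ℕ) : ℝ) / 3 = m := by push_cast; ring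
  rw [hcast]
  rcases Nat.eq_zero_or_pos m with rfl | hm
  · exact ⟨0, by simp, by simp, by simp, by simp⟩
  have hm' : (0 : ℝ) < m := by exact_mod_cast hm
  obtain ⟨w, ⟨hw0, hw1⟩, hw⟩ :=
    exists_convexWeights_of_forall_exists_sum_le E (fun _ => (m : ℝ)⁻¹) fun y => by
      obtain ⟨e, he, hle⟩ := exists_mem_sum_le_of_link_matchings hm hn E hE hlink y
      refine ⟨e, he, ?_⟩
      rw [← Finset.mul_sum]
      exact (le_inv_mul_iff₀ hm').mpr hle
  let W : Finset V → ℝ := fun e => if he : e ∈ E then m * w ⟨e, he⟩ else 0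
  have hW (e : E) : W e = m * w e := by simp [W]
  have hW0 (e : Finset V) : 0 ≤ W e := by
    dsimp only [W]
    split_ifs with he
    · exact mul_nonneg hm'.le (hw0 _)
    · exact le_rfl
  have hWE : ∀ e ∉ E, W e = 0 := fun e he => by simp [W, he]
  have hdeg (v : V) : ∑ e ∈ E with v ∈ e, W e = 1 := by
    rw [Finset.sum_filter, ← Finset.sum_coe_sort]
    simp only [hW]
    rw [← mul_inv_cancel₀ hm'.ne', ← hw v, Finset.mul_sum]
    simp only [mul_ite, mul_zero]
  refine ⟨W, fun e => ⟨hW0 e, ?_⟩, hWE, fun v => (hdeg v).le, ?_⟩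
  · by_cases he : e ∈ E
    · obtain ⟨v, hv⟩ : e.Nonempty := Finset.card_pos.mp (by rw [hE e he]; norm_num)
      rw [← hdeg v]
      exact Finset.single_le_sum (fun e _ => hW0 e) (Finset.mem_filter.mpr ⟨he, hv⟩)
    · rw [hWE e he]
      exact zero_le_one
  · rw [← Finset.sum_coe_sort]
    simp only [hW]
    rw [← Finset.mul_sum, hw1, mul_one]
end
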